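/- arXiv:1507.01513 — 6 statements merged into one kernel-verified Lean document; each statement's English description precedes it below -/
import Mathlib

section
/- Let (V, ≤) be a rooted forest poset. Then the rectilinear arboreal hypersurface admits the less redundant presentation H_V = ⋃_{α ∈ V} P_α° as subsets of ℝ^V. -/
/-- For a rooted forest poset `(V, ≤)`, the rectilinear arboreal hypersurface
`H_V = ⋃_α H_α`, where `H_α = {x | ∀ β ≤ α, x β ≥ 0, and ∃ γ ≤ α, x γ = 0}`, equals
`⋃_α P_α°`, where `P_α° = {x | x α = 0 and ∀ β < α, x β > 0}`. -/
theorem stmt1 {V : Type*} [Fintype V] [PartialOrder V]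
    (hforest : ∀ α : V, IsChain (· ≤ ·) {β : V | β ≤ α}) :
    (⋃ α : V, {x : V → ℝ | (∀ β ≤ α, 0 ≤ x β) ∧ ∃ γ ≤ α, x γ = 0}) =
      ⋃ α : V, {x : V → ℝ | x α = 0 ∧ ∀ β < α, 0 < x β} := by
  ext x
  simp only [Set.mem_iUnion, Set.mem_ofPred_eq]
  constructor
  · rintro ⟨α, hnonneg, γ, hγα, hγ⟩
    obtain ⟨μ, ⟨hμα, hμ⟩, hmin⟩ :=
      (Set.toFinite {γ : V | γ ≤ α ∧ x γ = 0}).exists_minimal ⟨γ, hγα, hγ⟩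
    refine ⟨μ, hμ, fun β hβ => ?_⟩
    have hβα : β ≤ α := hβ.le.trans hμα
    exact (hnonneg β hβα).lt_of_ne fun h => hβ.not_ge (hmin ⟨hβα, h.symm⟩ hβ.le)
  · rintro ⟨α, hα, hpos⟩
    refine ⟨α, fun β hβ => ?_, α, le_rfl, hα⟩
    rcases hβ.eq_or_lt with rfl | hlt
    · exact hα.ge
    · exact (hpos β hlt).le
end

section
/- Let (V, ≤) be a rooted forest poset, δ > 0, and f : ℝ² → ℝ a continuous function such that f(a, b) ≠ 0 whenever a < 0, and f(a, b) = a whenever |a| < δ and b > 2δ. Then for every x ∈ ℝ^V and every α ∈ V, if h_α(x) ≥ 0 then h_β(x) ≥ 0 for all β ≤ α. -/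
/-- A continuous function that does not vanish on the left half-plane `a < 0`, and takes a negative
value there, is negative on the whole half-plane. -/
theorem neg_of_continuous_of_ne_zero_on_left_half_plane {f : ℝ × ℝ → ℝ} (hf : Continuous f)
    (hne : ∀ a b : ℝ, a < 0 → f (a, b) ≠ 0) {a₀ b₀ : ℝ} (ha₀ : a₀ < 0) (hneg : f (a₀, b₀) < 0)
    {a : ℝ} (ha : a < 0) (b : ℝ) : f (a, b) < 0 := by
  by_contra! hpos
  have hconn : IsPreconnected (Set.Iio (0 : ℝ) ×ˢ (Set.univ : Set ℝ)) :=
    isPreconnected_Iio.prod isPreconnected_univ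
  obtain ⟨⟨c, d⟩, hc, hcd⟩ := hconn.intermediate_value (a := (a₀, b₀)) (b := (a, b))
    ⟨ha₀, trivial⟩ ⟨ha, trivial⟩ hf.continuousOn ⟨hneg.le, hpos⟩
  exact hne c d hc.1 hcd

/-- A nonempty finite chain has a greatest element. -/
theorem IsChain.exists_isGreatest_of_finite {α : Type*} [PartialOrder α] {s : Set α}
    (hs : IsChain (· ≤ ·) s) (hfin : s.Finite) (hne : s.Nonempty) : ∃ p, IsGreatest s p := by
  obtain ⟨p, hp⟩ := hfin.exists_maximal hne
  exact ⟨p, hp.prop, fun b hb => (hs.total hb hp.prop).elim id (hp.le_of_ge hb)⟩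

/-- Let `(V, ≤)` be a rooted forest poset (a finite partial order whose down-sets
are totally ordered), `δ > 0`, and `f : ℝ² → ℝ` continuous with `f (a, b) ≠ 0` whenever
`a < 0` and `f (a, b) = a` whenever `|a| < δ` and `b > 2δ`. Let `h : V → ℝ^V → ℝ` be the
family defined by recursion on the poset: `h α x = x α` for minimal `α`, and
`h α x = f (h α̂ x, x α)` where `α̂` is the parent (the greatest element of `{β | β < α}`)
otherwise. Then for every `x` and `α`, `h α x ≥ 0` implies `h β x ≥ 0` for all `β ≤ α`. -/
theorem stmt9 {V : Type*} [Fintype V] [PartialOrder V]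
    (hforest : ∀ α : V, IsChain (· ≤ ·) {β : V | β ≤ α})
    (δ : ℝ) (hδ : 0 < δ) (f : ℝ × ℝ → ℝ) (hf : Continuous f)
    (h1 : ∀ a b : ℝ, a < 0 → f (a, b) ≠ 0)
    (h2 : ∀ a b : ℝ, |a| < δ → 2 * δ < b → f (a, b) = a)
    (h : V → (V → ℝ) → ℝ)
    (hmin : ∀ α : V, IsMin α → ∀ x : V → ℝ, h α x = x α)
    (hrec : ∀ α p : V, IsGreatest {β : V | β < α} p → ∀ x : V → ℝ, h α x = f (h p x, x α)) :
    ∀ (x : V → ℝ) (α : V), 0 ≤ h α x → ∀ β ≤ α, 0 ≤ h β x := by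
  have hneg : ∀ a b : ℝ, a < 0 → f (a, b) < 0 := fun a b ha =>
    neg_of_continuous_of_ne_zero_on_left_half_plane hf h1 (a₀ := -(δ / 2)) (b₀ := 3 * δ)
      (by linarith)
      (by
        rw [h2 _ _ (by rw [abs_neg, abs_of_pos (by linarith)]; linarith) (by linarith)]
        linarith) ha b
  intro x α
  induction α using WellFoundedLT.induction with
  | ind α ih =>
    intro hα β hβ
    rcases hβ.eq_or_lt with rfl | hlt
    · exact hα
    obtain ⟨p, hp⟩ := ((hforest α).mono fun _ h => le_of_lt h).exists_isGreatest_of_finite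
      (Set.toFinite {β : V | β < α}) ⟨β, hlt⟩
    rw [hrec α p hp] at hα
    exact ih p hp.1 (not_lt.1 fun hlt => (hneg _ _ hlt).not_ge hα) β (hp.2 hlt)
end

section
/- Let (V, ≤) be a rooted forest poset and f : ℝ² → ℝ a continuously differentiable submersion, i.e., the derivative of f is nonzero at every point of ℝ². Then for every α ∈ V the function h_α : ℝ^V → ℝ is a continuously differentiable submersion: its (Fréchet) derivative is surjective, equivalently nonzero, at every point of ℝ^V. -/
/-- In a finite rooted forest every non-minimal element has a parent. -/
theorem exists_isGreatest_lt_of_not_isMin {V : Type*} [Finite V] [PartialOrder V] {α : V}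
    (hα : IsChain (· ≤ ·) {β : V | β ≤ α}) (hmin : ¬ IsMin α) :
    ∃ p, IsGreatest {β : V | β < α} p := by
  obtain ⟨b, hb⟩ := not_isMin_iff.mp hmin
  obtain ⟨p, hp⟩ := (Set.toFinite {β : V | β < α}).exists_maximal ⟨b, hb⟩
  refine ⟨p, hp.prop, fun β hβ => ?_⟩
  rcases hα.total (le_of_lt hβ) (le_of_lt hp.prop) with h | h
  · exact h
  · exact hp.le_of_ge hβ h

/-- The derivative of a function vanishes along a coordinate on which it does not depend. -/
theorem fderiv_single_eq_zero_of_forall_eq {V : Type*} [Fintype V] [DecidableEq V]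
    {g : (V → ℝ) → ℝ} (hg : Differentiable ℝ g) (α : V)
    (hdep : ∀ x y : V → ℝ, (∀ β, β ≠ α → x β = y β) → g x = g y) (x : V → ℝ) :
    fderiv ℝ g x (Pi.single α 1) = 0 := by
  rw [← (hg x).lineDeriv_eq_fderiv, lineDeriv]
  have hconst : (fun t : ℝ => g (x + t • Pi.single α 1)) = fun _ => g x := by
    funext t
    exact hdep _ _ fun β hβ => by simp [hβ]
  rw [hconst, deriv_const]

/-- If `g` is a submersion not depending on the coordinate `α` and `f` is a submersion, then
`x ↦ f (g x, x α)` has nonzero derivative. -/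
theorem fderiv_comp_prodMk_apply_ne_zero {V : Type*} [Fintype V]
    {f : ℝ × ℝ → ℝ} (hf : Differentiable ℝ f) (hsub : ∀ p, fderiv ℝ f p ≠ 0)
    {g : (V → ℝ) → ℝ} (hg : Differentiable ℝ g) (α : V)
    (hdep : ∀ x y : V → ℝ, (∀ β, β ≠ α → x β = y β) → g x = g y)
    {x : V → ℝ} (hgx : fderiv ℝ g x ≠ 0) :
    fderiv ℝ (fun y : V → ℝ => f (g y, y α)) x ≠ 0 := by
  classical
  have hd : HasFDerivAt (fun y : V → ℝ => f (g y, y α))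
      ((fderiv ℝ f (g x, x α)).comp
        ((fderiv ℝ g x).prod (ContinuousLinearMap.proj (R := ℝ) (φ := fun _ : V => ℝ) α))) x :=
    (hf _).hasFDerivAt.comp x ((hg x).hasFDerivAt.prodMk (hasFDerivAt_apply α x))
  rw [hd.fderiv]
  intro h0
  apply hsub (g x, x α)
  have happ (v : V → ℝ) : fderiv ℝ f (g x, x α) (fderiv ℝ g x v, v α) = 0 := by
    simpa using DFunLike.congr_fun h0 v
  have hsurj := LinearMap.surjective (f := (fderiv ℝ g x).toLinearMap)
    fun h => hgx (ContinuousLinearMap.coe_injective h)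
  ext1 <;> ext1
  · obtain ⟨v, hv⟩ := hsurj 1
    have hv' : fderiv ℝ g x v = 1 := hv
    have := happ (v - v α • Pi.single α 1)
    simpa [fderiv_single_eq_zero_of_forall_eq hg α hdep, hv'] using this
  · simpa [fderiv_single_eq_zero_of_forall_eq hg α hdep] using happ (Pi.single α 1)

/-- Let `(V, ≤)` be a rooted forest poset and `f : ℝ² → ℝ` a continuously
differentiable submersion (derivative nonzero everywhere). Let `h : V → ℝ^V → ℝ` be the
family defined by recursion on the poset: `h α x = x α` for minimal `α`, and
`h α x = f (h α̂ x, x α)` where `α̂` is the parent (the greatest element of `{β | β < α}`)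
otherwise. Then each `h α` is a continuously differentiable submersion: it is `C¹` and its
Fréchet derivative is surjective at every point. -/
theorem stmt10 {V : Type*} [Fintype V] [PartialOrder V]
    (hforest : ∀ α : V, IsChain (· ≤ ·) {β : V | β ≤ α})
    (f : ℝ × ℝ → ℝ) (hf : ContDiff ℝ 1 f) (hsub : ∀ p : ℝ × ℝ, fderiv ℝ f p ≠ 0)
    (h : V → (V → ℝ) → ℝ)
    (hmin : ∀ α : V, IsMin α → ∀ x : V → ℝ, h α x = x α)
    (hrec : ∀ α p : V, IsGreatest {β : V | β < α} p → ∀ x : V → ℝ, h α x = f (h p x, x α)) :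
    ∀ α : V, ContDiff ℝ 1 (h α) ∧
      ∀ x : V → ℝ, Function.Surjective (fderiv ℝ (h α) x) := by
  have key : ∀ α : V, ContDiff ℝ 1 (h α) ∧ (∀ x, fderiv ℝ (h α) x ≠ 0) ∧
      ∀ x y : V → ℝ, (∀ β ≤ α, x β = y β) → h α x = h α y := by
    intro α
    induction α using WellFoundedLT.induction with
    | ind α ih =>
      by_cases hα : IsMin α
      · have heq : h α = fun x => x α := funext (hmin α hα)
        rw [heq]
        refine ⟨contDiff_apply ℝ ℝ α, fun x h0 => ?_, fun x y hxy => hxy α le_rfl⟩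
        rw [(hasFDerivAt_apply α x).fderiv] at h0
        simpa using DFunLike.congr_fun h0 (fun _ => (1 : ℝ))
      · obtain ⟨p, hp⟩ := exists_isGreatest_lt_of_not_isMin (hforest α) hα
        have hpα : p < α := hp.1
        obtain ⟨hC, hne, hdep⟩ := ih p hpα
        have heq : h α = fun x => f (h p x, x α) := funext (hrec α p hp)
        rw [heq]
        refine ⟨hf.comp (hC.prodMk (contDiff_apply ℝ ℝ α)), fun x => ?_, fun x y hxy => ?_⟩
        · exact fderiv_comp_prodMk_apply_ne_zero (hf.differentiable one_ne_zero) hsub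
            (hC.differentiable one_ne_zero) α
            (fun x y hxy => hdep x y fun β hβ => hxy β (hβ.trans_lt hpα).ne) (hne x)
        · simp only [hdep x y fun β hβ => hxy β (hβ.trans hpα.le), hxy α le_rfl]
  intro α
  refine ⟨(key α).1, fun x => ?_⟩
  exact LinearMap.surjective (f := (fderiv ℝ (h α) x).toLinearMap)
    fun h0 => (key α).2.1 x (ContinuousLinearMap.coe_injective h0)
end

section
/- Let (V, ≤) be a rooted forest poset and f : ℝ² → ℝ a function such that f(a, b) = 0 implies a ≥ 0. For α ∈ V set sH_α = {x ∈ ℝ^V : h_α(x) = 0}; set sP_α = sH_α if α is minimal and sP_α = {x : h_α(x) = 0 and h_{α̂}(x) ≥ 0} otherwise; and set sP_α° = sH_α if α is minimal and sP_α° = {x : h_α(x) = 0 and h_{α̂}(x) > 0} otherwise. Then the smoothed arboreal hypersurface admits the less redundant presentations ⋃_{α∈V} sH_α = ⋃_{α∈V} sP_α = ⋃_{α∈V} sP_α°. -/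
/-- If every zero of `g` whose immediate predecessor is `p` satisfies `0 ≤ g p`, then as soon as
`g` has a zero it has one whose immediate predecessor, if any, carries a positive value. -/
theorem exists_eq_zero_forall_isGreatest_pos {V : Type*} [PartialOrder V] [WellFoundedLT V]
    {g : V → ℝ} (hg : ∀ α p : V, IsGreatest {β : V | β < α} p → g α = 0 → 0 ≤ g p)
    (α : V) (hα : g α = 0) :
    ∃ β : V, g β = 0 ∧ ∀ p : V, IsGreatest {γ : V | γ < β} p → 0 < g p := by
  induction α using WellFoundedLT.induction with
  | ind α ih =>
    by_cases hp : ∃ p : V, IsGreatest {γ : V | γ < α} p ∧ g p = 0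
    · obtain ⟨p, hp, hp0⟩ := hp
      exact ih p hp.1 hp0
    · exact ⟨α, hα, fun p hpα => (hg α p hpα hα).lt_of_ne fun h0 => hp ⟨p, hpα, h0.symm⟩⟩

/-- Let `(V, ≤)` be a rooted forest poset and `f : ℝ² → ℝ` a function with
`f (a, b) = 0 → a ≥ 0`. Let `h : V → ℝ^V → ℝ` be the family defined by recursion on the
poset: `h α x = x α` for minimal `α`, and `h α x = f (h α̂ x, x α)` where `α̂` is the parent
(the greatest element of `{β | β < α}`) otherwise. With `sH_α = {h α = 0}`,
`sP_α = {h α = 0, h α̂ ≥ 0}` (interpreted as `sH_α` for minimal `α`), and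
`sP_α° = {h α = 0, h α̂ > 0}` (interpreted as `sH_α` for minimal `α`), the smoothed arboreal
hypersurface admits the less redundant presentations
`⋃_α sH_α = ⋃_α sP_α = ⋃_α sP_α°`. -/
theorem stmt11 {V : Type*} [Fintype V] [PartialOrder V]
    (hforest : ∀ α : V, IsChain (· ≤ ·) {β : V | β ≤ α})
    (f : ℝ × ℝ → ℝ) (hf : ∀ a b : ℝ, f (a, b) = 0 → 0 ≤ a)
    (h : V → (V → ℝ) → ℝ)
    (hmin : ∀ α : V, IsMin α → ∀ x : V → ℝ, h α x = x α)
    (hrec : ∀ α p : V, IsGreatest {β : V | β < α} p → ∀ x : V → ℝ, h α x = f (h p x, x α)) :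
    (⋃ α : V, {x : V → ℝ | h α x = 0}) =
        (⋃ α : V, {x : V → ℝ |
          h α x = 0 ∧ ∀ p : V, IsGreatest {β : V | β < α} p → 0 ≤ h p x}) ∧
      (⋃ α : V, {x : V → ℝ |
          h α x = 0 ∧ ∀ p : V, IsGreatest {β : V | β < α} p → 0 ≤ h p x}) =
        ⋃ α : V, {x : V → ℝ |
          h α x = 0 ∧ ∀ p : V, IsGreatest {β : V | β < α} p → 0 < h p x} := by
  have nonneg (x : V → ℝ) (α p : V) (hp : IsGreatest {β : V | β < α} p) (hα : h α x = 0) :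
      0 ≤ h p x := hf _ (x α) (hrec α p hp x ▸ hα)
  constructor
  · ext x
    simp only [Set.mem_iUnion, Set.mem_ofPred_eq]
    exact ⟨fun ⟨α, hα⟩ => ⟨α, hα, fun p hp => nonneg x α p hp hα⟩,
      fun ⟨α, hα, _⟩ => ⟨α, hα⟩⟩
  · ext x
    simp only [Set.mem_iUnion, Set.mem_ofPred_eq]
    exact ⟨fun ⟨α, hα, _⟩ => exists_eq_zero_forall_isGreatest_pos (g := (h · x)) (nonneg x) α hα,
      fun ⟨α, hα, hpos⟩ => ⟨α, hα, fun p hp => (hpos p hp).le⟩⟩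
end

section
/- Let (V, ≤, ℓ, (·)⁺) be a leafy rooted forest poset. Then ⋃_{γ ∈ V} P_γ = (⋃_{γ ∈ V ∖ ℓ} P_γ) ∪ (⋃_{α ∈ ℓ} P*_α) as subsets of ℝ^V. That is, the rectilinear arboreal hypersurface of the associated rooted forest is the union of the generalized rectilinear arboreal hypersurface H = ⋃_{γ ∈ V ∖ ℓ} P_γ and the pieces P*_α for the marked leaves α ∈ ℓ. -/
/-- Let `(V, ≤, ℓ, (·)⁺)` be a leafy rooted forest poset: `(V, ≤)` is a finite
partial order whose down-sets are totally ordered, `ℓ ⊆ V`, and `α ↦ α⁺` is injective on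
`ℓ`, taking values in `V ∖ ℓ`, such that for each `α ∈ ℓ`: `α⁺` is maximal,
`{β | β < α⁺} = {β | β ≤ α}`, and `{β | β > α} = {α⁺}`. With
`P_γ = {x | x γ = 0, x β ≥ 0 for β < γ}` and
`P*_α = {x | x α = 0, x β > 0 for β < α, x (α⁺) ≠ 0}`, one has
`⋃_{γ ∈ V} P_γ = (⋃_{γ ∉ ℓ} P_γ) ∪ (⋃_{α ∈ ℓ} P*_α)`. -/
theorem stmt12 {V : Type*} [Fintype V] [PartialOrder V]
    (hforest : ∀ α : V, IsChain (· ≤ ·) {β : V | β ≤ α})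
    (ℓ : Set V) (plus : V → V)
    (hinj : Set.InjOn plus ℓ)
    (hout : ∀ α ∈ ℓ, plus α ∉ ℓ)
    (hmax : ∀ α ∈ ℓ, IsMax (plus α))
    (hdown : ∀ α ∈ ℓ, {β : V | β < plus α} = {β : V | β ≤ α})
    (hup : ∀ α ∈ ℓ, {β : V | α < β} = {plus α}) :
    (⋃ γ : V, {x : V → ℝ | x γ = 0 ∧ ∀ β < γ, 0 ≤ x β}) =
      (⋃ γ ∈ ℓᶜ, {x : V → ℝ | x γ = 0 ∧ ∀ β < γ, 0 ≤ x β}) ∪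
        ⋃ α ∈ ℓ, {x : V → ℝ | x α = 0 ∧ (∀ β < α, 0 < x β) ∧ x (plus α) ≠ 0} := by
  ext x
  simp only [Set.mem_iUnion, Set.mem_union, Set.mem_ofPred_eq, Set.mem_compl_iff, exists_prop]
  constructor
  · rintro ⟨γ, hγ, hnonneg⟩
    by_cases hγℓ : γ ∈ ℓ
    · by_cases hzero : ∃ β < γ, x β = 0
      · obtain ⟨β, hβγ, hβ⟩ := hzero
        refine Or.inl ⟨β, fun hβℓ => ?_, hβ, fun δ hδ => hnonneg δ (hδ.trans hβγ)⟩
        have hγβ : γ = plus β := (hup β hβℓ).subset hβγ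
        exact hout β hβℓ (hγβ ▸ hγℓ)
      · push Not at hzero
        by_cases hplus : x (plus γ) = 0
        · refine Or.inl ⟨plus γ, hout γ hγℓ, hplus, fun β hβ => ?_⟩
          have hβγ : β ≤ γ := (hdown γ hγℓ).subset hβ
          rcases hβγ.eq_or_lt with rfl | hlt
          · exact hγ.ge
          · exact hnonneg β hlt
        · exact Or.inr ⟨γ, hγℓ, hγ,
            fun β hβ => (hnonneg β hβ).lt_of_ne' (hzero β hβ), hplus⟩
    · exact Or.inl ⟨γ, hγℓ, hγ, hnonneg⟩
  · rintro (⟨γ, -, hγ⟩ | ⟨α, -, hα, hpos, -⟩)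
    · exact ⟨γ, hγ⟩
    · exact ⟨α, hα, fun β hβ => (hpos β hβ).le⟩
end

section
/- For every δ > 0 there exist functions b : ℝ → ℝ and f : ℝ² → ℝ with the following properties. b is continuous on ℝ and infinitely differentiable on ℝ ∖ {0}; |b(t)| < δ/4 for all t ∈ ℝ; b(t) = 0 for all t outside the open interval (0, δ/4); and the derivative b'(t) tends to −∞ as t → 0⁺. f is continuously differentiable with nowhere-vanishing derivative (a C¹ submersion); its zero locus is {(x₁, x₂) : f(x₁, x₂) = 0} = {x₁ = 0, x₂ ≥ 0} ∪ {x₁ > 0, x₂ = b(x₁)}; f(x₁, x₂) = x₂ whenever x₁ > 2δ and |x₂| < δ; f(x₁, x₂) = x₁ whenever |x₁| < δ and x₂ > 2δ; and f(x₁, x₂) < δ implies x₁ < δ or x₂ < δ. -/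
/-- A smooth function vanishing on `(-∞, 0]`, equal to the identity on `[c, ∞)` and strictly
increasing on `[0, ∞)`. -/
noncomputable def smoothRamp (c w : ℝ) : ℝ := w * Real.smoothTransition (w / c)

theorem contDiff_smoothRamp (c : ℝ) {n : ℕ∞} : ContDiff ℝ n (smoothRamp c) :=
  contDiff_id.mul (Real.smoothTransition.contDiff.comp (contDiff_id.div_const c))

theorem smoothRamp_of_nonpos {c w : ℝ} (hc : 0 < c) (hw : w ≤ 0) : smoothRamp c w = 0 := by
  rw [smoothRamp, Real.smoothTransition.zero_of_nonpos (div_nonpos_of_nonpos_of_nonneg hw hc.le),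
    mul_zero]

theorem smoothRamp_of_le {c w : ℝ} (hc : 0 < c) (hw : c ≤ w) : smoothRamp c w = w := by
  rw [smoothRamp, Real.smoothTransition.one_of_one_le ((one_le_div hc).2 hw), mul_one]

theorem smoothRamp_pos {c w : ℝ} (hc : 0 < c) (hw : 0 < w) : 0 < smoothRamp c w :=
  mul_pos hw (Real.smoothTransition.pos_of_pos (div_pos hw hc))

theorem smoothRamp_le_self {c w : ℝ} (hw : 0 ≤ w) : smoothRamp c w ≤ w :=
  mul_le_of_le_one_right hw (Real.smoothTransition.le_one _)

theorem hasDerivAt_smoothRamp (c w : ℝ) :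
    HasDerivAt (smoothRamp c)
      (Real.smoothTransition (w / c) + w * (deriv Real.smoothTransition (w / c) * (1 / c))) w := by
  have hs : HasDerivAt Real.smoothTransition (deriv Real.smoothTransition (w / c)) (w / c) :=
    ((Real.smoothTransition.contDiff (n := 1)).differentiable one_ne_zero _).hasDerivAt
  have h := (hasDerivAt_id w).mul (hs.comp w ((hasDerivAt_id w).div_const c))
  rw [one_mul] at h
  exact h

theorem deriv_smoothRamp_zero (c : ℝ) : deriv (smoothRamp c) 0 = 0 := by
  rw [(hasDerivAt_smoothRamp c 0).deriv]
  simp [Real.smoothTransition.zero]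

theorem deriv_smoothRamp_pos {c w : ℝ} (hc : 0 < c) (hw : 0 < w) :
    0 < deriv (smoothRamp c) w := by
  rw [(hasDerivAt_smoothRamp c w).deriv]
  have h₁ := Real.smoothTransition.pos_of_pos (div_pos hw hc)
  have h₂ : 0 ≤ deriv Real.smoothTransition (w / c) := Real.smoothTransition.monotone.deriv_nonneg
  positivity

/-- The odd extension of the restriction of `smoothRamp c` to `[0, ∞)`. -/
noncomputable def oddRamp (c w : ℝ) : ℝ := smoothRamp c w - smoothRamp c (-w)

theorem oddRamp_of_nonneg {c w : ℝ} (hc : 0 < c) (hw : 0 ≤ w) :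
    oddRamp c w = smoothRamp c w := by
  rw [oddRamp, smoothRamp_of_nonpos hc (neg_nonpos.2 hw), sub_zero]

theorem contDiff_oddRamp (c : ℝ) {n : ℕ∞} : ContDiff ℝ n (oddRamp c) :=
  (contDiff_smoothRamp c).sub ((contDiff_smoothRamp c).comp contDiff_neg)

theorem strictMono_oddRamp {c : ℝ} (hc : 0 < c) : StrictMono (oddRamp c) := by
  refine strictMono_of_odd_strictMonoOn_nonneg (fun w ↦ by simp [oddRamp]) ?_
  have hmono : StrictMonoOn (smoothRamp c) (Set.Ici 0) := by
    refine strictMonoOn_of_deriv_pos (convex_Ici 0)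
      (contDiff_smoothRamp c (n := 0)).continuous.continuousOn fun w hw ↦ ?_
    rw [interior_Ici] at hw
    exact deriv_smoothRamp_pos hc hw
  exact hmono.congr fun w hw ↦ (oddRamp_of_nonneg hc hw).symm

theorem surjective_oddRamp {c : ℝ} (hc : 0 < c) : Function.Surjective (oddRamp c) := by
  refine (contDiff_oddRamp c (n := 0)).continuous.surjective ?_ ?_
  · refine Filter.tendsto_id.congr' ?_
    filter_upwards [Filter.eventually_ge_atTop c] with w hw
    rw [oddRamp_of_nonneg hc (hc.le.trans hw), smoothRamp_of_le hc hw, id]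
  · refine Filter.tendsto_id.congr' ?_
    filter_upwards [Filter.eventually_le_atBot (-c)] with w hw
    rw [oddRamp, smoothRamp_of_nonpos hc (by linarith), smoothRamp_of_le hc (by linarith), id]
    ring

theorem hasDerivAt_oddRamp {c w : ℝ} (hc : 0 < c) (hw : 0 < w) :
    HasDerivAt (oddRamp c) (deriv (smoothRamp c) w) w := by
  refine (hasDerivAt_smoothRamp c w).differentiableAt.hasDerivAt.congr_of_eventuallyEq ?_
  filter_upwards [lt_mem_nhds hw] with v hv
  exact oddRamp_of_nonneg hc hv.le

/-- `oddRamp c` as a homeomorphism of the line. -/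
noncomputable def oddRampHomeomorph (c : ℝ) (hc : 0 < c) : ℝ ≃ₜ ℝ :=
  ((strictMono_oddRamp hc).orderIsoOfSurjective _ (surjective_oddRamp hc)).toHomeomorph

section Inverse

variable {c : ℝ} (hc : 0 < c)

theorem oddRampHomeomorph_apply (w : ℝ) : oddRampHomeomorph c hc w = oddRamp c w := rfl

theorem oddRampHomeomorph_symm_zero : (oddRampHomeomorph c hc).symm 0 = 0 := by
  rw [Homeomorph.symm_apply_eq, oddRampHomeomorph_apply]
  simp [oddRamp]

theorem oddRampHomeomorph_symm_pos {x : ℝ} (hx : 0 < x) :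
    0 < (oddRampHomeomorph c hc).symm x := by
  have h : oddRamp c ((oddRampHomeomorph c hc).symm x) = x :=
    (oddRampHomeomorph c hc).apply_symm_apply x
  refine (strictMono_oddRamp hc).lt_iff_lt.1 ?_
  rw [h]
  simpa [oddRamp] using hx

theorem smoothRamp_eq_iff {x w : ℝ} (hx : 0 < x) :
    smoothRamp c w = x ↔ w = (oddRampHomeomorph c hc).symm x := by
  constructor
  · intro h
    have hw : 0 < w := by
      by_contra! hw
      rw [smoothRamp_of_nonpos hc hw] at h
      exact hx.ne h
    rw [Homeomorph.eq_symm_apply, oddRampHomeomorph_apply, oddRamp_of_nonneg hc hw.le, h]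
  · rintro rfl
    rw [← oddRamp_of_nonneg hc (oddRampHomeomorph_symm_pos hc hx).le]
    exact (oddRampHomeomorph c hc).apply_symm_apply x

theorem hasDerivAt_oddRampHomeomorph_symm {x : ℝ} (hx : 0 < x) :
    HasDerivAt (oddRampHomeomorph c hc).symm
      (deriv (smoothRamp c) ((oddRampHomeomorph c hc).symm x))⁻¹ x := by
  have hw := oddRampHomeomorph_symm_pos hc hx
  exact (oddRampHomeomorph c hc).toOpenPartialHomeomorph.hasDerivAt_symm (Set.mem_univ x)
    (deriv_smoothRamp_pos hc hw).ne' (hasDerivAt_oddRamp hc hw)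

theorem contDiffAt_oddRampHomeomorph_symm {x : ℝ} (hx : 0 < x) {n : ℕ∞} :
    ContDiffAt ℝ n (oddRampHomeomorph c hc).symm x := by
  have hw := oddRampHomeomorph_symm_pos hc hx
  exact (oddRampHomeomorph c hc).toOpenPartialHomeomorph.contDiffAt_symm_deriv
    (deriv_smoothRamp_pos hc hw).ne' (Set.mem_univ x) (hasDerivAt_oddRamp hc hw)
    (contDiff_oddRamp c).contDiffAt

/-- The function whose graph over `(0, ∞)` is the part of `{x₁ = smoothRamp c (x₁ - x₂)}` with
`x₁ > 0`, extended by zero. -/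
noncomputable def cornerProfile (x : ℝ) : ℝ :=
  max x 0 - (oddRampHomeomorph c hc).symm (max x 0)

theorem continuous_cornerProfile : Continuous (cornerProfile hc) := by
  have h : Continuous fun x : ℝ ↦ max x 0 := continuous_id.max continuous_const
  exact h.sub ((oddRampHomeomorph c hc).symm.continuous.comp h)

theorem cornerProfile_of_nonpos {x : ℝ} (hx : x ≤ 0) : cornerProfile hc x = 0 := by
  rw [cornerProfile, max_eq_right hx, oddRampHomeomorph_symm_zero, sub_zero]

theorem cornerProfile_of_pos {x : ℝ} (hx : 0 < x) :
    cornerProfile hc x = x - (oddRampHomeomorph c hc).symm x := by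
  rw [cornerProfile, max_eq_left hx.le]

theorem cornerProfile_eventuallyEq {x : ℝ} (hx : 0 < x) :
    cornerProfile hc =ᶠ[nhds x] fun y ↦ y - (oddRampHomeomorph c hc).symm y := by
  filter_upwards [lt_mem_nhds hx] with y hy
  exact cornerProfile_of_pos hc hy

theorem cornerProfile_of_le {x : ℝ} (hx : c ≤ x) : cornerProfile hc x = 0 := by
  have hx₀ := hc.trans_le hx
  rw [cornerProfile_of_pos hc hx₀, ← (smoothRamp_eq_iff hc hx₀).1 (smoothRamp_of_le hc hx),
    sub_self]

theorem cornerProfile_of_notMem_Ioo {x : ℝ} (hx : x ∉ Set.Ioo 0 c) : cornerProfile hc x = 0 := by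
  rcases le_or_gt x 0 with h | h
  · exact cornerProfile_of_nonpos hc h
  · exact cornerProfile_of_le hc (not_lt.1 fun h' ↦ hx ⟨h, h'⟩)

theorem abs_cornerProfile_lt (x : ℝ) : |cornerProfile hc x| < c := by
  by_cases hx : x ∈ Set.Ioo 0 c
  · have hw := oddRampHomeomorph_symm_pos hc hx.1
    have hP := (smoothRamp_eq_iff hc hx.1).2 rfl
    have hle := smoothRamp_le_self (c := c) hw.le
    have hwc : (oddRampHomeomorph c hc).symm x < c := by
      by_contra! h
      rw [smoothRamp_of_le hc h] at hP
      linarith [hx.2]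
    rw [cornerProfile_of_pos hc hx.1, abs_lt]
    constructor <;> linarith [hx.1]
  · rwa [cornerProfile_of_notMem_Ioo hc hx, abs_zero]

theorem contDiffOn_cornerProfile {n : ℕ∞} : ContDiffOn ℝ n (cornerProfile hc) {(0 : ℝ)}ᶜ := by
  intro x hx
  refine ContDiffAt.contDiffWithinAt ?_
  rcases lt_or_gt_of_ne hx with h | h
  · refine (contDiffAt_const (c := (0 : ℝ))).congr_of_eventuallyEq ?_
    filter_upwards [gt_mem_nhds h] with y hy
    exact cornerProfile_of_nonpos hc hy.le
  · exact (contDiffAt_id.sub (contDiffAt_oddRampHomeomorph_symm hc h)).congr_of_eventuallyEq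
      (cornerProfile_eventuallyEq hc h)

theorem deriv_cornerProfile {x : ℝ} (hx : 0 < x) :
    deriv (cornerProfile hc) x =
      1 - (deriv (smoothRamp c) ((oddRampHomeomorph c hc).symm x))⁻¹ := by
  rw [(cornerProfile_eventuallyEq hc hx).deriv_eq]
  exact ((hasDerivAt_id x).sub (hasDerivAt_oddRampHomeomorph_symm hc hx)).deriv

theorem tendsto_deriv_cornerProfile :
    Filter.Tendsto (deriv (cornerProfile hc)) (nhdsWithin 0 (Set.Ioi 0)) Filter.atBot := by
  have hcont : Continuous fun x ↦ deriv (smoothRamp c) ((oddRampHomeomorph c hc).symm x) :=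
    ((contDiff_smoothRamp c (n := 1)).continuous_deriv le_rfl).comp
      (oddRampHomeomorph c hc).symm.continuous
  have h₀ : Filter.Tendsto (fun x ↦ deriv (smoothRamp c) ((oddRampHomeomorph c hc).symm x))
      (nhdsWithin 0 (Set.Ioi 0)) (nhdsWithin 0 (Set.Ioi 0)) := by
    refine tendsto_nhdsWithin_iff.2 ⟨?_, ?_⟩
    · have h := hcont.tendsto 0
      rw [oddRampHomeomorph_symm_zero, deriv_smoothRamp_zero] at h
      exact h.mono_left nhdsWithin_le_nhds
    · filter_upwards [self_mem_nhdsWithin] with x hx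
      exact deriv_smoothRamp_pos hc (oddRampHomeomorph_symm_pos hc hx)
  have h₁ := Filter.tendsto_atBot_add_const_left _ (1 : ℝ)
    (Filter.tendsto_neg_atTop_atBot.comp (tendsto_inv_nhdsGT_zero.comp h₀))
  refine h₁.congr' ?_
  filter_upwards [self_mem_nhdsWithin] with x hx
  rw [deriv_cornerProfile hc hx, sub_eq_add_neg]
  rfl

end Inverse

/-- A smooth defining function for the smoothed corner. -/
noncomputable def cornerFun (c : ℝ) (p : ℝ × ℝ) : ℝ := p.1 - smoothRamp c (p.1 - p.2)

theorem contDiff_cornerFun (c : ℝ) {n : ℕ∞} : ContDiff ℝ n (cornerFun c) :=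
  contDiff_fst.sub ((contDiff_smoothRamp c).comp (contDiff_fst.sub contDiff_snd))

theorem fderiv_cornerFun_ne_zero (c : ℝ) (p : ℝ × ℝ) : fderiv ℝ (cornerFun c) p ≠ 0 := by
  intro h
  have hf : HasFDerivAt (cornerFun c) (0 : ℝ × ℝ →L[ℝ] ℝ) p :=
    h ▸ ((contDiff_cornerFun c (n := 1)).differentiable one_ne_zero p).hasFDerivAt
  have hline : HasDerivAt (fun t : ℝ ↦ cornerFun c (p + t • (1, 1))) 0 0 :=
    hf.hasLineDerivAt (1, 1)
  have heq : (fun t : ℝ ↦ cornerFun c (p + t • (1, 1))) = fun t ↦ cornerFun c p + t := by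
    ext t
    simp [cornerFun]
    ring
  rw [heq] at hline
  exact zero_ne_one (hline.unique ((hasDerivAt_id (0 : ℝ)).const_add _))

theorem cornerFun_eq_zero_iff {c : ℝ} (hc : 0 < c) (p : ℝ × ℝ) :
    cornerFun c p = 0 ↔ p.1 = 0 ∧ 0 ≤ p.2 ∨ 0 < p.1 ∧ p.2 = cornerProfile hc p.1 := by
  rw [cornerFun, sub_eq_zero, eq_comm]
  rcases lt_trichotomy p.1 0 with h | h | h
  · have hnonneg : 0 ≤ smoothRamp c (p.1 - p.2) := by
      rcases le_or_gt (p.1 - p.2) 0 with hw | hw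
      · exact (smoothRamp_of_nonpos hc hw).ge
      · exact (smoothRamp_pos hc hw).le
    constructor
    · intro h'
      linarith
    · rintro (h' | h') <;> linarith [h'.1]
  · have hiff : smoothRamp c (p.1 - p.2) = 0 ↔ 0 ≤ p.2 := by
      constructor
      · intro h'
        by_contra! hneg
        exact (smoothRamp_pos hc (by linarith : 0 < p.1 - p.2)).ne' h'
      · intro h'
        exact smoothRamp_of_nonpos hc (by linarith)
    simp only [h] at hiff ⊢
    simpa using hiff
  · rw [smoothRamp_eq_iff hc h, cornerProfile_of_pos hc h]
    constructor
    · intro h'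
      exact Or.inr ⟨h, by linarith⟩
    · rintro (h' | h')
      · exact absurd h'.1 h.ne'
      · linarith [h'.2]

theorem min_le_cornerFun {c : ℝ} (hc : 0 < c) (p : ℝ × ℝ) : min p.1 p.2 ≤ cornerFun c p := by
  rw [cornerFun]
  rcases le_total (p.1 - p.2) 0 with h | h
  · rw [smoothRamp_of_nonpos hc h, sub_zero]
    exact min_le_left _ _
  · have := smoothRamp_le_self (c := c) h
    exact (min_le_right _ _).trans (by linarith)


/-- For every `δ > 0` there exist `b : ℝ → ℝ` and `f : ℝ² → ℝ` such that:
`b` is continuous on `ℝ` and smooth away from `0`; `|b t| < δ/4` for all `t`; `b t = 0`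
outside the interval `(0, δ/4)`; `b' t → −∞` as `t → 0⁺`; `f` is a `C¹` submersion (its
derivative never vanishes); the zero locus of `f` is
`{x₁ = 0, x₂ ≥ 0} ∪ {x₁ > 0, x₂ = b x₁}`; `f (x₁, x₂) = x₂` when `x₁ > 2δ` and `|x₂| < δ`;
`f (x₁, x₂) = x₁` when `|x₁| < δ` and `x₂ > 2δ`; and `f (x₁, x₂) < δ` implies `x₁ < δ` or
`x₂ < δ`. -/
theorem stmt16 (δ : ℝ) (hδ : 0 < δ) :
    ∃ (b : ℝ → ℝ) (f : ℝ × ℝ → ℝ),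
      Continuous b ∧
      ContDiffOn ℝ (⊤ : ℕ∞) b {(0 : ℝ)}ᶜ ∧
      (∀ t : ℝ, |b t| < δ / 4) ∧
      (∀ t : ℝ, t ∉ Set.Ioo (0 : ℝ) (δ / 4) → b t = 0) ∧
      Filter.Tendsto (deriv b) (nhdsWithin 0 (Set.Ioi 0)) Filter.atBot ∧
      ContDiff ℝ 1 f ∧
      (∀ p : ℝ × ℝ, fderiv ℝ f p ≠ 0) ∧
      ({p : ℝ × ℝ | f p = 0} =
        {p : ℝ × ℝ | p.1 = 0 ∧ 0 ≤ p.2} ∪ {p : ℝ × ℝ | 0 < p.1 ∧ p.2 = b p.1}) ∧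
      (∀ p : ℝ × ℝ, 2 * δ < p.1 → |p.2| < δ → f p = p.2) ∧
      (∀ p : ℝ × ℝ, |p.1| < δ → 2 * δ < p.2 → f p = p.1) ∧
      (∀ p : ℝ × ℝ, f p < δ → p.1 < δ ∨ p.2 < δ) := by
  have hc : 0 < δ / 4 := by positivity
  refine ⟨cornerProfile hc, cornerFun (δ / 4), continuous_cornerProfile hc,
    contDiffOn_cornerProfile hc, abs_cornerProfile_lt hc,
    fun t ht ↦ cornerProfile_of_notMem_Ioo hc ht, tendsto_deriv_cornerProfile hc,
    contDiff_cornerFun _, fderiv_cornerFun_ne_zero _, Set.ext (cornerFun_eq_zero_iff hc),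
    fun p h₁ h₂ ↦ ?_, fun p h₁ h₂ ↦ ?_, fun p h ↦ ?_⟩
  · rw [abs_lt] at h₂
    rw [cornerFun, smoothRamp_of_le hc (by linarith), sub_sub_cancel]
  · rw [abs_lt] at h₁
    rw [cornerFun, smoothRamp_of_nonpos hc (by linarith), sub_zero]
  · exact min_lt_iff.1 ((min_le_cornerFun hc p).trans_lt h)
end
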